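/- For any real y > 0, the map n ↦ y·ln(pₙ) mod 2π (where pₙ is the n-th prime) takes values in any fixed arc of length 2β (0 < β < π/2) for infinitely many n; moreover the sum of reciprocals of the corresponding primes diverges. -/

import Mathlib

open Real

open Filter Topology MeasureTheory ArithmeticFunction
open scoped LSeries.notation

/-- The weight `(s - 1) Λ(n) n⁻ˢ`; as `s → 1⁺` the total mass of these weights tends to `1`. -/
noncomputable def mangoldtWeight (s : ℝ) (n : ℕ) : ℝ := (s - 1) * (vonMangoldt n * (n : ℝ) ^ (-s))

lemma mangoldtWeight_nonneg {s : ℝ} (hs : 1 < s) (n : ℕ) : 0 ≤ mangoldtWeight s n :=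
  mul_nonneg (by linarith) (mul_nonneg vonMangoldt_nonneg (by positivity))

/-- Twisting the weights by `n ^ (i t)` gives the `L`-series of `Λ` at `s - i t`. -/
lemma mangoldtWeight_mul_exp (s t : ℝ) (n : ℕ) :
    (mangoldtWeight s n : ℂ) * Complex.exp (t * Real.log n * Complex.I) =
      (s - 1 : ℂ) * LSeries.term (fun n ↦ (vonMangoldt n : ℂ)) (s - t * Complex.I) n := by
  rcases eq_or_ne n 0 with rfl | hn
  · simp [mangoldtWeight]
  have hn' : (n : ℂ) ≠ 0 := by exact_mod_cast hn
  rw [LSeries.term_of_ne_zero hn, div_eq_mul_inv, ← Complex.cpow_neg, neg_sub,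
    sub_eq_add_neg (t * Complex.I),
    Complex.cpow_add _ _ hn', mangoldtWeight]
  have h1 : (n : ℂ) ^ (t * Complex.I) = Complex.exp (t * Real.log n * Complex.I) := by
    rw [Complex.cpow_def_of_ne_zero hn', ← Complex.natCast_log]
    ring_nf
  rw [h1]
  push_cast [Complex.ofReal_cpow n.cast_nonneg]
  ring

lemma summable_mangoldtWeight {s : ℝ} (hs : 1 < s) : Summable (mangoldtWeight s) := by
  have h := (LSeriesSummable_vonMangoldt (s := s) (by simpa using hs)).mul_left (s - 1 : ℂ)
  rw [← Complex.summable_ofReal]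
  refine h.congr fun n ↦ ?_
  simpa using (mangoldtWeight_mul_exp s 0 n).symm

/-- The `L`-series of `Λ` has on the closed half plane `1 ≤ re z` only a simple pole, at `1`. -/
lemma exists_continuousOn_LSeries_vonMangoldt_eq : ∃ F : ℂ → ℂ, ContinuousOn F {z | 1 ≤ z.re} ∧
    ∀ z : ℂ, 1 < z.re → L ↗vonMangoldt z = F z + 1 / (z - 1) := by
  refine ⟨vonMangoldt.LFunctionResidueClassAux (1 : ZMod 1),
    vonMangoldt.continuousOn_LFunctionResidueClassAux 1, fun z hz ↦ ?_⟩
  rw [vonMangoldt.eqOn_LFunctionResidueClassAux (q := 1) isUnit_one hz]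
  have h : vonMangoldt.residueClass (1 : ZMod 1) = fun n ↦ vonMangoldt n := by
    ext n
    simp [vonMangoldt.residueClass, Subsingleton.elim _ (1 : ZMod 1)]
  simp [h]

lemma tendsto_tsum_mangoldtWeight_mul_exp (t : ℝ) :
    Tendsto (fun s : ℝ ↦
      ∑' n : ℕ, (mangoldtWeight s n : ℂ) * Complex.exp (t * Real.log n * Complex.I))
      (𝓝[>] 1) (𝓝 (if t = 0 then 1 else 0)) := by
  obtain ⟨F, hF, hLF⟩ := exists_continuousOn_LSeries_vonMangoldt_eq
  have hs0 : Tendsto (fun s : ℝ ↦ (s - 1 : ℂ)) (𝓝[>] 1) (𝓝 0) :=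
    tendsto_nhdsWithin_of_tendsto_nhds <| by
      have : Continuous (fun s : ℝ ↦ (s - 1 : ℂ)) := by fun_prop
      simpa using this.tendsto 1
  have hFt : Tendsto (fun s : ℝ ↦ F (s - t * Complex.I)) (𝓝[>] 1) (𝓝 (F (1 - t * Complex.I))) := by
    refine (hF (1 - t * Complex.I) (by simp)).tendsto.comp (tendsto_nhdsWithin_iff.2 ⟨?_, ?_⟩)
    · refine tendsto_nhdsWithin_of_tendsto_nhds ?_
      have : Continuous (fun s : ℝ ↦ (s - t * Complex.I : ℂ)) := by fun_prop
      simpa using this.tendsto 1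
    · filter_upwards [self_mem_nhdsWithin] with s hs
      simpa using (Set.mem_Ioi.1 hs).le
  have hpole : Tendsto (fun s : ℝ ↦ (s - 1 : ℂ) / (s - 1 - t * Complex.I)) (𝓝[>] 1)
      (𝓝 (if t = 0 then 1 else 0)) := by
    split_ifs with ht
    · refine tendsto_const_nhds.congr' ?_
      filter_upwards [self_mem_nhdsWithin] with s hs
      have : (s - 1 : ℂ) ≠ 0 := by exact_mod_cast (sub_pos.2 (Set.mem_Ioi.1 hs)).ne'
      simp [ht, this]
    · simpa [Pi.div_def] using hs0.div (hs0.sub_const (t * Complex.I)) (by simp [ht])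
  have := (hs0.mul hFt).add hpole
  rw [zero_mul, zero_add] at this
  refine this.congr' ?_
  filter_upwards [self_mem_nhdsWithin] with s hs
  simp_rw [mangoldtWeight_mul_exp, tsum_mul_left]
  have h := hLF (s - t * Complex.I) (by simpa using hs)
  rw [LSeries] at h
  rw [h, mul_add]
  congr 1
  ring

lemma integral_fourier_haarAddCircle {T : ℝ} [hT : Fact (0 < T)] (m : ℤ) :
    ∫ x, fourier (T := T) m x ∂AddCircle.haarAddCircle = if m = 0 then 1 else 0 := by
  split_ifs with hm
  · simp [hm]
  · exact integral_eq_zero_of_add_right_eq_neg (fourier_add_half_inv_index hm hT.out)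

lemma norm_tsum_mangoldtWeight_mul_le {s : ℝ} (hs : 1 < s) {a : ℕ → ℂ} {C : ℝ}
    (ha : ∀ n, ‖a n‖ ≤ C) :
    Summable (fun n ↦ (mangoldtWeight s n : ℂ) * a n) ∧
    ‖∑' n, (mangoldtWeight s n : ℂ) * a n‖ ≤ (∑' n, mangoldtWeight s n) * C := by
  have hle (n : ℕ) : ‖(mangoldtWeight s n : ℂ) * a n‖ ≤ mangoldtWeight s n * C := by
    rw [norm_mul, Complex.norm_of_nonneg (mangoldtWeight_nonneg hs n)]
    exact mul_le_mul_of_nonneg_left (ha n) (mangoldtWeight_nonneg hs n)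
  have hsum := (summable_mangoldtWeight hs).mul_right C
  refine ⟨.of_norm_bounded hsum hle, ?_⟩
  rw [← tsum_mul_right]
  exact tsum_of_norm_bounded hsum.hasSum hle

lemma tendsto_tsum_mangoldtWeight :
    Tendsto (fun s : ℝ ↦ ∑' n : ℕ, mangoldtWeight s n) (𝓝[>] 1) (𝓝 1) := by
  have h := tendsto_tsum_mangoldtWeight_mul_exp 0
  simp only [Complex.ofReal_zero, zero_mul, Complex.exp_zero, mul_one, if_true,
    ← Complex.ofReal_tsum] at h
  simpa [Function.comp_def] using (Complex.continuous_re.tendsto _).comp h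

instance fact_two_pi_pos : Fact (0 < 2 * π) := ⟨two_pi_pos⟩

/-- For `y ≠ 0` the points `y log n` modulo `2π`, weighted by `(s - 1) Λ(n) n⁻ˢ`,
equidistribute on the circle as `s → 1⁺`. -/
lemma tendsto_tsum_mangoldtWeight_mul_apply {y : ℝ} (hy : y ≠ 0) (f : C(AddCircle (2 * π), ℂ)) :
    Tendsto (fun s : ℝ ↦
      ∑' n : ℕ, (mangoldtWeight s n : ℂ) * f ((y * Real.log n : ℝ) : AddCircle (2 * π)))
      (𝓝[>] 1) (𝓝 (∫ x, f x ∂AddCircle.haarAddCircle)) := by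
  have hmem : f ∈ (Submodule.span ℂ (Set.range (fourier (T := 2 * π)))).topologicalClosure := by
    rw [span_fourier_closure_eq_top]; trivial
  have hint (g : C(AddCircle (2 * π), ℂ)) : Integrable g AddCircle.haarAddCircle :=
    g.continuous.integrable_of_hasCompactSupport (.of_compactSpace _)
  have hsum {s : ℝ} (hs : 1 < s) (g : C(AddCircle (2 * π), ℂ)) :=
    norm_tsum_mangoldtWeight_mul_le hs (a := fun n : ℕ ↦ g (y * Real.log n : ℝ))
      fun n ↦ g.norm_coe_le_norm _
  have hspan : ∀ g ∈ Submodule.span ℂ (Set.range (fourier (T := 2 * π))), Tendsto (fun s : ℝ ↦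
      ∑' n : ℕ, (mangoldtWeight s n : ℂ) * g ((y * Real.log n : ℝ) : AddCircle (2 * π)))
      (𝓝[>] 1) (𝓝 (∫ x, g x ∂AddCircle.haarAddCircle)) := by
    intro g hg
    induction hg using Submodule.span_induction with
    | mem g hg =>
      obtain ⟨m, rfl⟩ := hg
      have h := tendsto_tsum_mangoldtWeight_mul_exp (m * y)
      simp only [mul_eq_zero, hy, or_false, Int.cast_eq_zero] at h
      rw [integral_fourier_haarAddCircle]
      refine h.congr fun s ↦ tsum_congr fun n ↦ ?_
      rw [fourier_coe_apply]
      congr 2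
      have : (π : ℂ) ≠ 0 := by exact_mod_cast pi_ne_zero
      push_cast
      field_simp
    | zero => simp
    | add g h _ _ ihg ihh =>
      simp only [ContinuousMap.add_apply]
      rw [integral_add (hint g) (hint h)]
      refine (ihg.add ihh).congr' ?_
      filter_upwards [self_mem_nhdsWithin] with s hs
      rw [← (hsum hs g).1.tsum_add (hsum hs h).1]
      simp_rw [mul_add]
    | smul c g _ ih =>
      simp only [ContinuousMap.smul_apply, smul_eq_mul]
      rw [integral_const_mul]
      refine (ih.const_mul c).congr fun s ↦ ?_
      rw [← tsum_mul_left]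
      exact tsum_congr fun n ↦ by ring
  rw [Metric.tendsto_nhds]
  intro ε hε
  obtain ⟨g, hg, hfg⟩ := Metric.mem_closure_iff.1 hmem (ε / 4) (by positivity)
  rw [dist_eq_norm] at hfg
  filter_upwards [self_mem_nhdsWithin, Metric.tendsto_nhds.1 (hspan g hg) (ε / 4) (by positivity),
    tendsto_tsum_mangoldtWeight.eventually_le_const one_lt_two] with s hs h1 h2
  have hdiff : ‖∑' n : ℕ, (mangoldtWeight s n : ℂ) * (f - g) (y * Real.log n : ℝ)‖ ≤
      2 * (ε / 4) :=
    (hsum hs (f - g)).2.trans (mul_le_mul h2 hfg.le (norm_nonneg _) zero_le_two)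
  simp only [ContinuousMap.sub_apply, mul_sub] at hdiff
  rw [(hsum hs f).1.tsum_sub (hsum hs g).1] at hdiff
  have hI : ‖∫ x, g x ∂AddCircle.haarAddCircle - ∫ x, f x ∂AddCircle.haarAddCircle‖ < ε / 4 := by
    rw [norm_sub_rev, ← integral_sub (hint f) (hint g)]
    refine lt_of_le_of_lt ?_ hfg
    simpa using norm_integral_le_of_norm_le_const (μ := AddCircle.haarAddCircle)
      (Eventually.of_forall fun x ↦ (f - g).norm_coe_le_norm x)
  rw [dist_eq_norm] at h1 ⊢
  refine (norm_sub_le_norm_sub_add_norm_sub _ _ _).trans_lt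
    (lt_of_le_of_lt (add_le_add hdiff (norm_sub_le_norm_sub_add_norm_sub _
      (∫ x, g x ∂AddCircle.haarAddCircle) _)) ?_)
  linarith

lemma mangoldtWeight_le_one_div {s : ℝ} (hs : 1 < s) (n : ℕ) : mangoldtWeight s n ≤ 1 / n := by
  rcases eq_or_ne n 0 with rfl | hn
  · simp [mangoldtWeight]
  have hn' : (0 : ℝ) < n := by positivity
  have hs' : 0 < s - 1 := sub_pos.2 hs
  have hlog := (vonMangoldt_le_log (n := n)).trans (Real.log_le_rpow_div hn'.le hs')
  rw [le_div_iff₀ hs'] at hlog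
  calc mangoldtWeight s n = (vonMangoldt n * (s - 1)) * (n : ℝ) ^ (-s) := by
        rw [mangoldtWeight]; ring
    _ ≤ (n : ℝ) ^ (s - 1) * (n : ℝ) ^ (-s) := by gcongr
    _ = 1 / n := by
        rw [← Real.rpow_add hn', show s - 1 + -s = -1 by ring, Real.rpow_neg_one, one_div]

lemma mangoldtWeight_le_vonMangoldt_div {s : ℝ} (hs : 1 < s) (hs2 : s ≤ 2) (n : ℕ) :
    mangoldtWeight s n ≤ vonMangoldt n / n := by
  rcases eq_or_ne n 0 with rfl | hn
  · simp [mangoldtWeight]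
  have hn' : (1 : ℝ) ≤ n := by exact_mod_cast Nat.one_le_iff_ne_zero.2 hn
  have hpow : (n : ℝ) ^ (-s) ≤ (n : ℝ)⁻¹ := by
    rw [← Real.rpow_neg_one]
    exact Real.rpow_le_rpow_of_exponent_le hn' (by linarith)
  have hΛ : 0 ≤ vonMangoldt n * (n : ℝ) ^ (-s) := mul_nonneg vonMangoldt_nonneg (by positivity)
  calc mangoldtWeight s n ≤ vonMangoldt n * (n : ℝ) ^ (-s) :=
        mul_le_of_le_one_left hΛ (by linarith)
    _ ≤ vonMangoldt n / n := mul_le_mul_of_nonneg_left hpow vonMangoldt_nonneg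

lemma tendsto_mangoldtWeight_zero (n : ℕ) :
    Tendsto (fun s ↦ mangoldtWeight s n) (𝓝[>] 1) (𝓝 0) := by
  rcases eq_or_ne n 0 with rfl | hn
  · simp [mangoldtWeight]
  have hn' : (n : ℝ) ≠ 0 := by exact_mod_cast hn
  have : Continuous fun s ↦ mangoldtWeight s n := by
    unfold mangoldtWeight
    exact (continuous_id.sub continuous_const).mul
      (continuous_const.mul (continuous_const.rpow continuous_neg fun _ ↦ .inl hn'))
  refine tendsto_nhdsWithin_of_tendsto_nhds ?_
  simpa [mangoldtWeight] using this.tendsto 1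

lemma summable_vonMangoldt_div_of_not_prime :
    Summable fun n : ℕ ↦ (if n.Prime then 0 else vonMangoldt n) / n := by
  refine (vonMangoldt.summable_residueClass_non_primes_div (1 : ZMod 1)).congr fun n ↦ ?_
  simp [vonMangoldt.residueClass, Subsingleton.elim _ (1 : ZMod 1)]

/-- If the reciprocals of a set of primes are summable, then the weights `(s - 1) Λ(n) n⁻ˢ`,
summed against a bounded function vanishing at all primes outside that set, tend to `0`. -/
lemma tendsto_tsum_mangoldtWeight_mul_zero {S : Set ℕ}
    (hS : Summable (S.indicator fun n : ℕ ↦ (1 : ℝ) / n)) {a : ℕ → ℂ} (ha : ∀ n, ‖a n‖ ≤ 1)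
    (haS : ∀ p : ℕ, p.Prime → p ∉ S → a p = 0) :
    Tendsto (fun s : ℝ ↦ ∑' n : ℕ, (mangoldtWeight s n : ℂ) * a n) (𝓝[>] 1) (𝓝 0) := by
  rw [← tsum_zero (α := ℂ) (β := ℕ)]
  refine tendsto_tsum_of_dominated_convergence
    (hS.add summable_vonMangoldt_div_of_not_prime) (fun n ↦ ?_) ?_
  · simpa using ((Complex.continuous_ofReal.tendsto _).comp
      (tendsto_mangoldtWeight_zero n)).mul_const (a n)
  · filter_upwards [self_mem_nhdsWithin,
      mem_nhdsWithin_of_mem_nhds (Iic_mem_nhds one_lt_two)] with s hs hs2 n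
    have hw := mangoldtWeight_nonneg hs n
    have hΛ : 0 ≤ (if n.Prime then 0 else vonMangoldt n) / n :=
      div_nonneg (by split_ifs <;> simp [vonMangoldt_nonneg]) n.cast_nonneg
    have hI : 0 ≤ S.indicator (fun n : ℕ ↦ (1 : ℝ) / n) n :=
      Set.indicator_nonneg (fun _ _ ↦ by positivity) _
    have hnorm : ‖(mangoldtWeight s n : ℂ) * a n‖ ≤ mangoldtWeight s n := by
      rw [norm_mul, Complex.norm_of_nonneg hw]
      exact mul_le_of_le_one_right hw (ha n)
    by_cases hp : n.Prime
    · by_cases hn : n ∈ S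
      · refine hnorm.trans ((mangoldtWeight_le_one_div hs n).trans ?_)
        simpa [hn] using hΛ
      · rw [haS n hp hn, mul_zero, norm_zero]
        positivity
    · refine hnorm.trans ((mangoldtWeight_le_vonMangoldt_div hs hs2 n).trans ?_)
      simpa [hp] using hI

/-- The tent function of height `1` on the arc of radius `β` around `c`. -/
noncomputable def circleTent (c : AddCircle (2 * π)) (β : ℝ) : C(AddCircle (2 * π), ℂ) where
  toFun x := (max 0 (1 - ‖x - c‖ / β) : ℝ)

lemma norm_circleTent_le (c : AddCircle (2 * π)) {β : ℝ} (hβ : 0 < β) (x : AddCircle (2 * π)) :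
    ‖circleTent c β x‖ ≤ 1 := by
  change ‖((max 0 (1 - ‖x - c‖ / β) : ℝ) : ℂ)‖ ≤ 1
  rw [Complex.norm_of_nonneg (le_max_left _ _)]
  have : 0 ≤ ‖x - c‖ / β := by positivity
  exact max_le zero_le_one (by linarith)

lemma norm_sub_lt_of_circleTent_ne_zero {c : AddCircle (2 * π)} {β : ℝ} (hβ : 0 < β)
    {x : AddCircle (2 * π)} (hx : circleTent c β x ≠ 0) : ‖x - c‖ < β := by
  contrapose! hx
  change ((max 0 (1 - ‖x - c‖ / β) : ℝ) : ℂ) = 0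
  rw [max_eq_left (by linarith [(one_le_div hβ).2 hx]), Complex.ofReal_zero]

lemma integral_circleTent_ne_zero (c : AddCircle (2 * π)) (β : ℝ) :
    ∫ x, circleTent c β x ∂AddCircle.haarAddCircle ≠ 0 := by
  change ∫ x, ((max 0 (1 - ‖x - c‖ / β) : ℝ) : ℂ) ∂AddCircle.haarAddCircle ≠ 0
  rw [integral_complex_ofReal, Complex.ofReal_ne_zero]
  have hcont : Continuous fun x : AddCircle (2 * π) ↦ max (0 : ℝ) (1 - ‖x - c‖ / β) :=
    continuous_const.max (by fun_prop)
  exact (hcont.integral_pos_of_hasCompactSupport_nonneg_nonzero (x := c)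
    (.of_compactSpace _) (fun _ ↦ le_max_left _ _) (by simp)).ne'

theorem not_summable_one_div_prime_of_log_mem_arc {y β : ℝ} (hy : 0 < y) (hβ : 0 < β) (θ : ℝ) :
    ¬ Summable (fun p : {p : ℕ // p.Prime ∧ ∃ k : ℕ,
        2 * k * π + θ - β < y * Real.log p ∧ y * Real.log p ≤ 2 * k * π + θ + β} =>
      (1 : ℝ) / p) := by
  intro hsum
  set A : Set ℕ := {p | p.Prime ∧ ∃ k : ℕ,
    2 * k * π + θ - β < y * Real.log p ∧ y * Real.log p ≤ 2 * k * π + θ + β}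
  have hsumA : Summable (A.indicator fun n : ℕ ↦ (1 : ℝ) / n) :=
    summable_subtype_iff_indicator.1 hsum
  -- primes below `N` may only satisfy the arc condition with a negative `k`
  obtain ⟨N, hN⟩ := exists_nat_gt (Real.exp ((θ + β) / y))
  have hsumU : Summable ((A ∪ Set.Iio N).indicator fun n : ℕ ↦ (1 : ℝ) / n) := by
    refine hsumA.congr_cofinite ?_
    filter_upwards [(Set.finite_Iio N).compl_mem_cofinite] with n hn
    have hmem : n ∈ A ∪ Set.Iio N ↔ n ∈ A := or_iff_left hn
    by_cases h : n ∈ A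
    · rw [Set.indicator_of_mem h, Set.indicator_of_mem (hmem.2 h)]
    · rw [Set.indicator_of_notMem h, Set.indicator_of_notMem (mt hmem.1 h)]
  refine integral_circleTent_ne_zero (θ : AddCircle (2 * π)) β
    (tendsto_nhds_unique (tendsto_tsum_mangoldtWeight_mul_apply hy.ne' _)
      (tendsto_tsum_mangoldtWeight_mul_zero hsumU (fun n ↦ norm_circleTent_le _ hβ _) ?_))
  intro p hp hpU
  by_contra hne
  have hlt := norm_sub_lt_of_circleTent_ne_zero hβ hne
  rw [← AddCircle.coe_sub, AddCircle.norm_eq, abs_lt] at hlt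
  simp only [Set.mem_union, Set.mem_Iio, not_or, not_lt] at hpU
  have hlarge : θ + β < y * Real.log p := by
    have hNp : Real.exp ((θ + β) / y) < p := hN.trans_le (by exact_mod_cast hpU.2)
    rw [← div_lt_iff₀' hy]
    exact (Real.lt_log_iff_exp_lt (by exact_mod_cast hp.pos)).2 hNp
  generalize round ((2 * π)⁻¹ * (y * Real.log p - θ)) = k at hlt
  have hk : 0 ≤ k := by
    by_contra! hk
    have : (k : ℝ) ≤ -1 := by exact_mod_cast Int.le_sub_one_of_lt hk
    nlinarith [pi_pos]
  lift k to ℕ using hk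
  push_cast at hlt
  exact hpU.1 ⟨hp, k, by linarith, by linarith⟩

theorem stmt_16 (y β : ℝ) (hy : 0 < y) (hβ0 : 0 < β) (hβπ : β < π / 2) (θ : ℝ) :
    {n : ℕ | ∃ k : ℕ, 2 * k * π + θ - β < y * Real.log (Nat.nth Nat.Prime n) ∧
        y * Real.log (Nat.nth Nat.Prime n) ≤ 2 * k * π + θ + β}.Infinite ∧
    ¬ Summable (fun p : {p : ℕ // p.Prime ∧ ∃ k : ℕ,
        2 * k * π + θ - β < y * Real.log p ∧ y * Real.log p ≤ 2 * k * π + θ + β} =>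
      (1 : ℝ) / p) := by
  have hdiv := not_summable_one_div_prime_of_log_mem_arc hy hβ0 θ
  refine ⟨fun hfin ↦ hdiv ?_, hdiv⟩
  have hfinP : {p : ℕ | p.Prime ∧ ∃ k : ℕ, 2 * k * π + θ - β < y * Real.log p ∧
      y * Real.log p ≤ 2 * k * π + θ + β}.Finite := by
    refine (hfin.image (Nat.nth Nat.Prime)).subset fun p hp ↦ ?_
    have hnth := Nat.nth_count hp.1
    exact ⟨Nat.count Nat.Prime p, by simpa only [Set.mem_ofPred_eq, hnth] using hp.2, hnth⟩
  have := hfinP.to_subtype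
  exact (Summable.of_finite : Summable fun p : {p : ℕ | p.Prime ∧ ∃ k : ℕ,
    2 * k * π + θ - β < y * Real.log p ∧ y * Real.log p ≤ 2 * k * π + θ + β} ↦ (1 : ℝ) / p)
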